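/- Let n ≥ 2, let 1 ≤ j ≤ n−1, and let A, A' ∈ GL(n, ℂ) be matrices determining the same complete flag, F_A• = F_{A'}•. Then for every z ∈ ℂ there exists a unique w ∈ ℂ such that F_{A·B_j(z)}• = F_{A'·B_j(w)}•. -/

import Mathlib

noncomputable section

/-- The span of the first `i` columns of the matrix `M`. -/
def colSpan (n : ℕ) (M : Matrix (Fin n) (Fin n) ℂ) (i : ℕ) : Submodule ℂ (Fin n → ℂ) :=
  Submodule.span ℂ ((fun j : Fin n => (fun r => M r j)) '' {j : Fin n | (j : ℕ) < i})

/-- The matrix `B_j(z)`: the identity except in the (1-indexed) rows and columns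
`j, j+1`, where it is the block `[[z, -1], [1, 0]]`. -/
def Bmat (n : ℕ) (j : ℕ) (z : ℂ) : Matrix (Fin n) (Fin n) ℂ :=
  Matrix.of fun a b =>
    if ((a : ℕ) + 1, (b : ℕ) + 1) = (j, j) then z
    else if ((a : ℕ) + 1, (b : ℕ) + 1) = (j, j + 1) then -1
    else if ((a : ℕ) + 1, (b : ℕ) + 1) = (j + 1, j) then 1
    else if ((a : ℕ) + 1, (b : ℕ) + 1) = (j + 1, j + 1) then 0
    else if a = b then 1 else 0

/-- The `k`-th column of `M * B_{p+1}(z)`, for `p + 1 < n`. -/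
lemma mul_Bmat_col {n : ℕ} (M : Matrix (Fin n) (Fin n) ℂ) (z : ℂ) {p q : Fin n}
    (hpq : (q : ℕ) = p + 1) (k : Fin n) :
    (M * Bmat n (p + 1) z).col k =
      if k = p then z • M.col p + M.col q else if k = q then -M.col p else M.col k := by
  have hB : ∀ a, Bmat n (p + 1) z a k =
      if k = p then (if a = p then z else 0) + (if a = q then 1 else 0)
      else if k = q then (if a = p then -1 else 0) else if a = k then 1 else 0 := by
    intro a
    simp only [Bmat, Matrix.of_apply, Prod.mk.injEq, Fin.ext_iff]
    split_ifs <;> first | omega | simp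
  ext r
  simp only [Matrix.col_apply, Matrix.mul_apply, hB]
  split_ifs <;> simp [mul_add, Finset.sum_add_distrib, mul_comm]

lemma colSpan_eq_span_col (n : ℕ) (M : Matrix (Fin n) (Fin n) ℂ) (i : ℕ) :
    colSpan n M i = Submodule.span ℂ (M.col '' {k : Fin n | (k : ℕ) < i}) := rfl

lemma col_mem_colSpan {n : ℕ} (M : Matrix (Fin n) (Fin n) ℂ) {i : ℕ} {k : Fin n}
    (hk : (k : ℕ) < i) : M.col k ∈ colSpan n M i :=
  Submodule.subset_span ⟨k, hk, rfl⟩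

lemma colSpan_le {n : ℕ} {M : Matrix (Fin n) (Fin n) ℂ} {i : ℕ}
    {S : Submodule ℂ (Fin n → ℂ)} (h : ∀ k : Fin n, (k : ℕ) < i → M.col k ∈ S) :
    colSpan n M i ≤ S := by
  rw [colSpan_eq_span_col, Submodule.span_le]
  rintro _ ⟨k, hk, rfl⟩
  exact h k hk

lemma colSpan_congr {n : ℕ} {M N : Matrix (Fin n) (Fin n) ℂ} {i : ℕ}
    (h : ∀ k : Fin n, (k : ℕ) < i → M.col k = N.col k) : colSpan n M i = colSpan n N i :=
  le_antisymm (colSpan_le fun k hk => h k hk ▸ col_mem_colSpan N hk)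
    (colSpan_le fun k hk => h k hk ▸ col_mem_colSpan M hk)

lemma colSpan_mono {n : ℕ} (M : Matrix (Fin n) (Fin n) ℂ) {i i' : ℕ} (h : i ≤ i') :
    colSpan n M i ≤ colSpan n M i' :=
  colSpan_le fun _ hk => col_mem_colSpan M (hk.trans_le h)

lemma colSpan_succ {n : ℕ} (M : Matrix (Fin n) (Fin n) ℂ) (k : Fin n) :
    colSpan n M (k + 1) = Submodule.span ℂ {M.col k} ⊔ colSpan n M k := by
  have h : {l : Fin n | (l : ℕ) < k + 1} = insert k {l : Fin n | (l : ℕ) < k} := by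
    ext l
    simp only [Set.mem_ofPred_eq, Set.mem_insert_iff, Fin.ext_iff]
    omega
  rw [colSpan_eq_span_col, h, Set.image_insert_eq, Submodule.span_insert]
  rfl

lemma mem_colSpan_succ {n : ℕ} {M : Matrix (Fin n) (Fin n) ℂ} {k : Fin n} {x : Fin n → ℂ} :
    x ∈ colSpan n M (k + 1) ↔ ∃ c : ℂ, ∃ s ∈ colSpan n M k, c • M.col k + s = x := by
  rw [colSpan_succ, Submodule.mem_sup]
  simp [Submodule.mem_span_singleton]

lemma col_notMem_colSpan {n : ℕ} (A : GL (Fin n) ℂ) (k : Fin n) :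
    (A : Matrix (Fin n) (Fin n) ℂ).col k ∉ colSpan n A k := by
  have h := Matrix.linearIndependent_cols_of_isUnit A.isUnit
  rw [colSpan_eq_span_col]
  exact h.notMem_span_image (by simp)

/-- Multiplying by `B_{p+1}(z)` only changes the `(p+1)`-st subspace of the flag. -/
lemma colSpan_mul_Bmat_of_ne {n : ℕ} (M : Matrix (Fin n) (Fin n) ℂ) (z : ℂ) {p q : Fin n}
    (hpq : (q : ℕ) = p + 1) {i : ℕ} (hi : i ≠ p + 1) :
    colSpan n (M * Bmat n (p + 1) z) i = colSpan n M i := by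
  have hne : q ≠ p := by rintro rfl; omega
  rcases lt_or_gt_of_ne hi with hlt | hgt
  · refine colSpan_congr fun k hk => ?_
    rw [mul_Bmat_col M z hpq, if_neg (by rintro rfl; omega), if_neg (by rintro rfl; omega)]
  · have hp : (p : ℕ) < i := by omega
    have hq : (q : ℕ) < i := by omega
    apply le_antisymm
    · refine colSpan_le fun k hk => ?_
      rw [mul_Bmat_col M z hpq]
      split_ifs
      · exact add_mem (Submodule.smul_mem _ _ (col_mem_colSpan M hp)) (col_mem_colSpan M hq)
      · exact neg_mem (col_mem_colSpan M hp)
      · exact col_mem_colSpan M hk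
    · have hcp := col_mem_colSpan (M * Bmat n (p + 1) z) hp
      have hcq := col_mem_colSpan (M * Bmat n (p + 1) z) hq
      rw [mul_Bmat_col M z hpq, if_pos rfl] at hcp
      rw [mul_Bmat_col M z hpq, if_neg hne, if_pos rfl, neg_mem_iff] at hcq
      refine colSpan_le fun k hk => ?_
      by_cases hkp : k = p
      · exact hkp ▸ hcq
      by_cases hkq : k = q
      · exact hkq ▸ (add_mem_cancel_left (Submodule.smul_mem _ z hcq)).1 hcp
      have hck := col_mem_colSpan (M * Bmat n (p + 1) z) hk
      rwa [mul_Bmat_col M z hpq, if_neg hkp, if_neg hkq] at hck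

lemma colSpan_mul_Bmat_succ {n : ℕ} (M : Matrix (Fin n) (Fin n) ℂ) (z : ℂ) {p q : Fin n}
    (hpq : (q : ℕ) = p + 1) :
    colSpan n (M * Bmat n (p + 1) z) (p + 1) =
      Submodule.span ℂ {z • M.col p + M.col q} ⊔ colSpan n M p := by
  rw [colSpan_succ, mul_Bmat_col M z hpq, if_pos rfl, colSpan_mul_Bmat_of_ne M z hpq (by omega)]

/-- Distinct parameters give distinct `(p+1)`-st subspaces. -/
lemma eq_of_colSpan_mul_Bmat_eq {n : ℕ} (A : GL (Fin n) ℂ) {p q : Fin n}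
    (hpq : (q : ℕ) = p + 1) {w w' : ℂ}
    (h : colSpan n (A * Bmat n (p + 1) w) (p + 1) = colSpan n (A * Bmat n (p + 1) w') (p + 1)) :
    w = w' := by
  rw [colSpan_mul_Bmat_succ _ _ hpq, colSpan_mul_Bmat_succ _ _ hpq] at h
  have hmem := h.le (Submodule.mem_sup_left (Submodule.mem_span_singleton_self _))
  obtain ⟨y, hy, s, hs, hys⟩ := Submodule.mem_sup.1 hmem
  obtain ⟨t, rfl⟩ := Submodule.mem_span_singleton.1 hy
  set a := (A : Matrix (Fin n) (Fin n) ℂ).col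
  have ht : t = 1 := by
    by_contra ht
    refine col_notMem_colSpan A q ((Submodule.smul_mem_iff _ (sub_ne_zero.2 ht)).1 ?_)
    have e : (t - 1) • a q = (w - t * w') • a p - s := by
      linear_combination (norm := module) hys
    rw [e, hpq]
    exact sub_mem (Submodule.smul_mem _ _ (col_mem_colSpan _ (Nat.lt_succ_self _)))
      (colSpan_mono _ (Nat.le_succ _) hs)
  by_contra hw
  refine col_notMem_colSpan A p ((Submodule.smul_mem_iff _ (sub_ne_zero.2 hw)).1 ?_)
  have e : (w - w') • a p = s := by
    subst ht
    linear_combination (norm := module) -hys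
  exact e ▸ hs

lemma exists_colSpan_mul_Bmat_eq {n : ℕ} {A A' : GL (Fin n) ℂ}
    (hAA' : ∀ i : ℕ, colSpan n (A : Matrix (Fin n) (Fin n) ℂ) i =
      colSpan n (A' : Matrix (Fin n) (Fin n) ℂ) i) {p q : Fin n}
    (hpq : (q : ℕ) = p + 1) (z : ℂ) :
    ∃ w : ℂ, colSpan n (A * Bmat n (p + 1) z) (p + 1) =
      colSpan n (A' * Bmat n (p + 1) w) (p + 1) := by
  obtain ⟨c, s, hs, hp⟩ := mem_colSpan_succ.1
    ((hAA' (p + 1)).le (col_mem_colSpan _ (Nat.lt_succ_self p)))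
  obtain ⟨d, t, ht, hq⟩ := mem_colSpan_succ.1
    ((hAA' (q + 1)).le (col_mem_colSpan _ (Nat.lt_succ_self q)))
  have hd : d ≠ 0 := by
    rintro rfl
    rw [zero_smul, zero_add] at hq
    exact col_notMem_colSpan A q (hAA' q ▸ hq ▸ ht)
  rw [hpq] at ht
  obtain ⟨e, s', hs', rfl⟩ := mem_colSpan_succ.1 ht
  refine ⟨(z * c + e) / d, ?_⟩
  rw [colSpan_mul_Bmat_succ _ _ hpq, colSpan_mul_Bmat_succ _ _ hpq, hAA' p]
  set a := (A : Matrix (Fin n) (Fin n) ℂ).col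
  set a' := (A' : Matrix (Fin n) (Fin n) ℂ).col
  set S := colSpan n (A' : Matrix (Fin n) (Fin n) ℂ) p
  have hsS : z • s + s' ∈ S := add_mem (Submodule.smul_mem _ _ hs) hs'
  have key : z • a p + a q = d • (((z * c + e) / d) • a' p + a' q) + (z • s + s') := by
    rw [← hp, ← hq, smul_add d, smul_smul, mul_div_cancel₀ _ hd]
    module
  apply le_antisymm
  · refine sup_le ((Submodule.span_singleton_le_iff_mem _ _).2 ?_) le_sup_right
    rw [key]
    exact Submodule.add_mem_sup (Submodule.smul_mem _ _ (Submodule.mem_span_singleton_self _)) hsS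
  · refine sup_le ((Submodule.span_singleton_le_iff_mem _ _).2 ?_) le_sup_right
    rw [← Submodule.smul_mem_iff _ hd, eq_sub_of_add_eq key.symm]
    exact sub_mem (Submodule.mem_sup_left (Submodule.mem_span_singleton_self _))
      (Submodule.mem_sup_right hsS)

/-- If `A, A' ∈ GL(n, ℂ)` determine the same complete flag, then for every `z ∈ ℂ`
there is a unique `w ∈ ℂ` with `F_{A·B_j(z)}• = F_{A'·B_j(w)}•`. -/
theorem reparametrization_of_position_j (n : ℕ) (hn : 2 ≤ n)
    (j : ℕ) (hj1 : 1 ≤ j) (hj2 : j ≤ n - 1) (A A' : GL (Fin n) ℂ)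
    (hAA' : ∀ i : ℕ, colSpan n (A : Matrix (Fin n) (Fin n) ℂ) i =
      colSpan n (A' : Matrix (Fin n) (Fin n) ℂ) i) :
    ∀ z : ℂ, ∃! w : ℂ,
      (fun i : ℕ => colSpan n ((A : Matrix (Fin n) (Fin n) ℂ) * Bmat n j z) i) =
        fun i : ℕ => colSpan n ((A' : Matrix (Fin n) (Fin n) ℂ) * Bmat n j w) i := by
  intro z
  obtain ⟨p, rfl⟩ := Nat.exists_eq_add_of_le' hj1
  have hp : p + 1 < n := by omega
  have hpq : ((⟨p + 1, hp⟩ : Fin n) : ℕ) = (⟨p, by omega⟩ : Fin n) + 1 := rfl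
  obtain ⟨w, hw⟩ := exists_colSpan_mul_Bmat_eq hAA' hpq z
  refine ⟨w, funext fun i => ?_, fun w' hw' => ?_⟩
  · by_cases hi : i = p + 1
    · exact hi ▸ hw
    · exact (colSpan_mul_Bmat_of_ne _ z hpq hi).trans
        ((hAA' i).trans (colSpan_mul_Bmat_of_ne _ w hpq hi).symm)
  · exact eq_of_colSpan_mul_Bmat_eq A' hpq ((congrFun hw' (p + 1)).symm.trans hw)
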